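/- arXiv:math/0607505 — 2 statements merged into one kernel-verified Lean document; each statement's English description precedes it below -/
import Mathlib

section
/- The colour densities ρ^i(φ₁,φ₂) := E_{ν_{φ₁,φ₂}}[η_i] (i = 1, 2, where η₁ and η₂ denote the two coordinates on ℕ × ℕ) are differentiable on (0,∞)², with ∂ρ^i/∂φ_j = φ_j^{−1} ( E_{ν_{φ₁,φ₂}}[η_i η_j] − ρ^i ρ^j ) for all i, j ∈ {1,2}, and the determinant of the 2×2 Jacobian matrix (∂ρ^i/∂φ_j)_{i,j} is strictly positive at every (φ₁,φ₂) ∈ (0,∞)². -/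
noncomputable section

/-- `c(k)! = ∏_{m=1}^k c(m)`, with `c(0)! = 1`. -/
def cfact (c : ℕ → ℝ) : ℕ → ℝ
  | 0 => 1
  | k + 1 => cfact c k * c (k + 1)

/-- The partition function `Z(φ) = ∑_{k ≥ 0} φ^k / c(k)!`. -/
def Zfun (c : ℕ → ℝ) (φ : ℝ) : ℝ := ∑' k : ℕ, φ ^ k / cfact c k

/-- The two-colour single-site measure
`ν_{φ₁,φ₂}({(k,m)}) = φ₁^k φ₂^m binom(k+m,k) / (c(k+m)! Z(φ₁+φ₂))`. -/
def nu2 (c : ℕ → ℝ) (φ₁ φ₂ : ℝ) (p : ℕ × ℕ) : ℝ :=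
  φ₁ ^ p.1 * φ₂ ^ p.2 * ((p.1 + p.2).choose p.1 : ℝ) /
    (cfact c (p.1 + p.2) * Zfun c (φ₁ + φ₂))

/-- Colour-1 density `ρ¹(φ₁,φ₂) = E_{ν}[η₁]`. -/
def rho1 (c : ℕ → ℝ) (φ₁ φ₂ : ℝ) : ℝ := ∑' p : ℕ × ℕ, (p.1 : ℝ) * nu2 c φ₁ φ₂ p

/-- Colour-2 density `ρ²(φ₁,φ₂) = E_{ν}[η₂]`. -/
def rho2 (c : ℕ → ℝ) (φ₁ φ₂ : ℝ) : ℝ := ∑' p : ℕ × ℕ, (p.2 : ℝ) * nu2 c φ₁ φ₂ p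

lemma hs_congr {ι : Type*} {f g : ι → ℝ} {S : ℝ} (h : HasSum f S) (e : ∀ i, g i = f i) :
    HasSum g S := (funext e : g = f) ▸ h

lemma aux_t (c : ℕ → ℝ) (a₂ : ℝ) (k₀ : ℕ)
    (hcpos : ∀ k : ℕ, 1 ≤ k → 0 < c k) (hc0 : c 0 = 0)
    (hk₀ : 1 ≤ k₀) (ha₂ : 0 < a₂)
    (hM : ∀ k : ℕ, a₂ ≤ c (k + k₀) - c k) : Filter.Tendsto c Filter.atTop Filter.atTop := by
  have h0 : ∀ k, 0 ≤ c k := by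
    intro k
    rcases Nat.eq_zero_or_pos k with h | h
    · rw [h, hc0]
    · exact (hcpos k h).le
  have h1 : ∀ j r : ℕ, a₂ * j ≤ c (r + k₀ * j) := by
    intro j r
    induction j with
    | zero => simpa using h0 r
    | succ j ih =>
      have := hM (r + k₀ * j)
      rw [show r + k₀ * (j+1) = r + k₀ * j + k₀ by ring]
      push_cast
      linarith
  have h2 : ∀ n : ℕ, a₂ * ((n / k₀ : ℕ) : ℝ) ≤ c n := by
    intro n
    have := h1 (n / k₀) (n % k₀)
    rwa [Nat.mod_add_div] at this
  refine Filter.tendsto_atTop_mono h2 ?_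
  refine Filter.Tendsto.const_mul_atTop ha₂ ?_
  exact tendsto_natCast_atTop_atTop.comp (Nat.tendsto_div_const_atTop (by omega))

lemma cfact_pos' (c : ℕ → ℝ) (hcpos : ∀ k : ℕ, 1 ≤ k → 0 < c k) (n : ℕ) : 0 < cfact c n := by
  induction n with
  | zero => simp [cfact]
  | succ n ih => rw [cfact]; exact mul_pos ih (hcpos _ (by omega))

lemma aux_summ (c : ℕ → ℝ) (hcpos : ∀ k : ℕ, 1 ≤ k → 0 < c k)
    (ht : Filter.Tendsto c Filter.atTop Filter.atTop) (r : ℝ) (hr : 0 < r) :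
    Summable (fun n => (cfact c n)⁻¹ * r ^ n) := by
  have hp := cfact_pos' c hcpos
  refine summable_of_ratio_test_tendsto_lt_one (l := 0) one_pos ?_ ?_
  · exact Filter.Eventually.of_forall fun n => (mul_pos (inv_pos.2 (hp n)) (pow_pos hr n)).ne'
  · have : Filter.Tendsto (fun n => r / c (n+1)) Filter.atTop (nhds 0) :=
      (ht.comp (Filter.tendsto_add_atTop_nat 1)).const_div_atTop r
    refine this.congr fun n => ?_
    have h1 := hp n
    have h2 := hcpos (n+1) (by omega)
    rw [Real.norm_of_nonneg (mul_pos (inv_pos.2 (hp _)) (pow_pos hr _)).le,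
      Real.norm_of_nonneg (mul_pos (inv_pos.2 (hp _)) (pow_pos hr _)).le, cfact]
    field_simp
    ring

/-- entire nonnegative coefficient sequences -/
def Ent (a : ℕ → ℝ) : Prop := (∀ n, 0 ≤ a n) ∧ ∀ r : ℝ, 0 < r → Summable (fun n => a n * r ^ n)

/-- shifted derivative coefficients -/
def Dc (a : ℕ → ℝ) : ℕ → ℝ := fun n => ((n : ℝ) + 1) * a (n + 1)

/-- power series -/
def Ps (a : ℕ → ℝ) (x : ℝ) : ℝ := ∑' n, a n * x ^ n

lemma Ent.aux {a : ℕ → ℝ} (h : Ent a) {r : ℝ} (hr : 0 < r) :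
    Summable (fun n : ℕ => (n : ℝ) * a n * r ^ n) := by
  refine Summable.of_nonneg_of_le (fun n => ?_) (fun n => ?_) (h.2 (2 * r) (by positivity))
  · have := h.1 n; positivity
  · have h1 := h.1 n
    have h2 : (n : ℝ) ≤ 2 ^ n := by exact_mod_cast (Nat.lt_two_pow_self (n := n)).le
    have h3 : 0 ≤ a n * r ^ n := by positivity
    rw [mul_pow]
    nlinarith

lemma Ent.D {a : ℕ → ℝ} (h : Ent a) : Ent (Dc a) := by
  refine ⟨fun n => ?_, fun r hr => ?_⟩
  · have := h.1 (n+1); unfold Dc; positivity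
  · have := ((summable_nat_add_iff 1).2 (h.aux hr)).mul_left r⁻¹
    refine this.congr fun n => ?_
    unfold Dc
    push_cast
    field_simp
    ring

lemma Ent.hasSum {a : ℕ → ℝ} (h : Ent a) {r : ℝ} (hr : 0 < r) :
    HasSum (fun n => a n * r ^ n) (Ps a r) := (h.2 r hr).hasSum

lemma Ent.hasSumD {a : ℕ → ℝ} (h : Ent a) {r : ℝ} (hr : 0 < r) :
    HasSum (fun n : ℕ => (n : ℝ) * a n * r ^ n) (r * Ps (Dc a) r) := by
  rw [← hasSum_nat_add_iff' 1]
  have := (h.D.hasSum hr).mul_left r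
  simp only [Finset.range_one, Finset.sum_singleton, Nat.cast_zero, zero_mul, sub_zero]
  refine hs_congr this fun n => ?_
  unfold Dc
  push_cast
  ring

lemma Ent.deriv {a : ℕ → ℝ} (h : Ent a) {x : ℝ} (hx : 0 < x) :
    HasDerivAt (Ps a) (Ps (Dc a) x) x := by
  have key := hasDerivAt_tsum_of_isPreconnected (𝕜 := ℝ) (t := Set.Ioo 0 (2 * x))
    (u := fun n : ℕ => (2 * x)⁻¹ * ((n : ℝ) * a n * (2 * x) ^ n)) (g := fun (n : ℕ) y => a n * y ^ n)
    (g' := fun (n : ℕ) y => a n * (n * y ^ (n - 1))) (y₀ := x) (y := x)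
    ((h.aux (by positivity)).mul_left _) isOpen_Ioo isPreconnected_Ioo
    (fun n y _ => (hasDerivAt_pow n y).const_mul _) ?_ ⟨hx, by linarith⟩ (h.2 x hx)
    ⟨hx, by linarith⟩
  · refine key.congr_deriv ?_
    have := (h.hasSumD hx).mul_left x⁻¹
    rw [inv_mul_cancel_left₀ hx.ne'] at this
    rw [← this.tsum_eq]
    refine tsum_congr fun n => ?_
    rcases n with _ | n
    · simp
    · simp only [Nat.add_sub_cancel]; field_simp; ring
  · rintro n y ⟨h1, h2⟩
    have h3 := h.1 n
    rw [Real.norm_of_nonneg (by positivity)]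
    rcases n with _ | n
    · simp
    · have : y ^ n ≤ (2 * x) ^ n := pow_le_pow_left₀ h1.le h2.le n
      calc _ = (((n+1 : ℕ) : ℝ) * a (n+1)) * y ^ n := by simp only [Nat.add_sub_cancel]; ring
        _ ≤ (((n+1 : ℕ) : ℝ) * a (n+1)) * (2 * x) ^ n := by gcongr
        _ = _ := by field_simp; ring

/-- two-colour term -/
def Tm (a : ℕ → ℝ) (x y : ℝ) (p : ℕ × ℕ) : ℝ :=
  x ^ p.1 * y ^ p.2 * ((p.1 + p.2).choose p.1 : ℝ) * a (p.1 + p.2)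

lemma Ent.two {a : ℕ → ℝ} (h : Ent a) {x y : ℝ} (hx : 0 < x) (hy : 0 < y) :
    HasSum (Tm a x y) (Ps a (x + y)) := by
  have hxy : 0 < x + y := by positivity
  have hfib : ∀ n, ∑ p ∈ Finset.HasAntidiagonal.antidiagonal n, Tm a x y p = a n * (x + y) ^ n := by
    intro n
    rw [(Commute.all x y).add_pow', Finset.mul_sum]
    refine Finset.sum_congr rfl fun p hp => ?_
    rw [Finset.HasAntidiagonal.mem_antidiagonal] at hp
    simp only [Tm, hp, nsmul_eq_mul]
    ring
  have hf : ∀ n, HasSum (fun q : Finset.HasAntidiagonal.antidiagonal n => Tm a x y q) (a n * (x + y) ^ n) := by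
    intro n
    rw [← hfib n]
    exact Finset.hasSum _ _
  rw [← Finset.HasAntidiagonal.sigmaAntidiagonalEquivProd.hasSum_iff]
  have hs : Summable (Tm a x y ∘ (Finset.HasAntidiagonal.sigmaAntidiagonalEquivProd (A := ℕ))) := by
    rw [summable_sigma_of_nonneg]
    · refine ⟨fun n => (hf n).summable, ?_⟩
      exact (h.2 _ hxy).congr fun n => (hf n).tsum_eq.symm
    · intro p
      have := h.1 ((Finset.HasAntidiagonal.sigmaAntidiagonalEquivProd p).1 + (Finset.HasAntidiagonal.sigmaAntidiagonalEquivProd p).2)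
      simp only [Function.comp, Tm]
      positivity
  exact (h.hasSum hxy).unique (hs.hasSum.sigma hf) ▸ hs.hasSum

lemma shift1 {a : ℕ → ℝ} {x y : ℝ} {f : ℕ × ℕ → ℝ} {S : ℝ}
    (h : HasSum (fun p : ℕ × ℕ => f (p.1 + 1, p.2) * Tm (Dc a) x y p) S) :
    HasSum (fun p : ℕ × ℕ => (p.1 : ℝ) * f p * Tm a x y p) (x * S) := by
  have inj : Function.Injective (fun p : ℕ × ℕ => (p.1 + 1, p.2)) := by
    rintro ⟨a, b⟩ ⟨c, d⟩ h
    simpa using h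
  rw [← inj.hasSum_iff]
  · refine hs_congr (h.mul_left x) fun p => ?_
    obtain ⟨k, m⟩ := p
    simp only [Function.comp, Tm, Dc]
    have := Nat.add_one_mul_choose_eq (k + m) k
    have h' : ((k:ℝ) + m + 1) * ((k+m).choose k : ℝ) = ((k+m+1).choose (k+1) : ℝ) * (k+1) := by
      exact_mod_cast this
    rw [show k + 1 + m = k + m + 1 by ring]
    push_cast
    linear_combination (-(f (k+1,m) * x ^ (k+1) * y ^ m * a (k+m+1))) * h'
  · rintro ⟨k, m⟩ hk
    rcases k with _ | k
    · simp
    · exact absurd ⟨(k, m), rfl⟩ hk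

lemma Tm_swap (a : ℕ → ℝ) (x y : ℝ) (p : ℕ × ℕ) : Tm a x y p.swap = Tm a y x p := by
  obtain ⟨k, m⟩ := p
  simp only [Tm, Prod.swap]
  rw [Nat.choose_symm_add, add_comm m k]
  ring

lemma swapSum {a : ℕ → ℝ} {x y : ℝ} {f : ℕ × ℕ → ℝ} {S : ℝ}
    (h : HasSum (fun p : ℕ × ℕ => f p * Tm a x y p) S) :
    HasSum (fun p : ℕ × ℕ => f p.swap * Tm a y x p) S := by
  have := (Equiv.prodComm ℕ ℕ).hasSum_iff.2 h
  convert this using 2 with p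
  simp only [Function.comp, Equiv.prodComm_apply, Tm_swap]

lemma Ent.m1 {a : ℕ → ℝ} (h : Ent a) {x y : ℝ} (hx : 0 < x) (hy : 0 < y) :
    HasSum (fun p : ℕ × ℕ => (p.1 : ℝ) * Tm a x y p) (x * Ps (Dc a) (x + y)) := by
  have := shift1 (f := fun _ => 1) (a := a) (x := x) (y := y) (S := Ps (Dc a) (x + y))
    (by simpa using h.D.two hx hy)
  simpa using this

lemma Ent.m2 {a : ℕ → ℝ} (h : Ent a) {x y : ℝ} (hx : 0 < x) (hy : 0 < y) :
    HasSum (fun p : ℕ × ℕ => (p.2 : ℝ) * Tm a x y p) (y * Ps (Dc a) (x + y)) := by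
  have := swapSum (h.m1 hy hx)
  rw [add_comm y x] at this
  exact this

lemma Ent.m11 {a : ℕ → ℝ} (h : Ent a) {x y : ℝ} (hx : 0 < x) (hy : 0 < y) :
    HasSum (fun p : ℕ × ℕ => (p.1 : ℝ) * (p.1 : ℝ) * Tm a x y p)
      (x * (x * Ps (Dc (Dc a)) (x + y) + Ps (Dc a) (x + y))) := by
  refine shift1 (f := fun p => (p.1 : ℝ)) ?_
  convert (h.D.m1 hx hy).add (h.D.two hx hy) using 2 with p
  push_cast
  ring

lemma Ent.m12 {a : ℕ → ℝ} (h : Ent a) {x y : ℝ} (hx : 0 < x) (hy : 0 < y) :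
    HasSum (fun p : ℕ × ℕ => (p.1 : ℝ) * (p.2 : ℝ) * Tm a x y p)
      (x * (y * Ps (Dc (Dc a)) (x + y))) :=
  shift1 (f := fun p => (p.2 : ℝ)) (h.D.m2 hx hy)

lemma Ent.m22 {a : ℕ → ℝ} (h : Ent a) {x y : ℝ} (hx : 0 < x) (hy : 0 < y) :
    HasSum (fun p : ℕ × ℕ => (p.2 : ℝ) * (p.2 : ℝ) * Tm a x y p)
      (y * (y * Ps (Dc (Dc a)) (x + y) + Ps (Dc a) (x + y))) := by
  have := swapSum (f := fun p => (p.1 : ℝ) * (p.1 : ℝ)) (h.m11 hy hx)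
  rw [add_comm y x] at this
  exact this

lemma Ps_pos {a : ℕ → ℝ} (h : Ent a) (h0 : 0 < a 0) {x : ℝ} (hx : 0 < x) : 0 < Ps a x := by
  refine (h.2 x hx).tsum_pos (fun n => ?_) 0 (by simpa using h0)
  have := h.1 n; positivity

lemma strictCS {a : ℕ → ℝ} (h : Ent a) (h0 : 0 < a 0) (h1 : 0 < a 1) {x : ℝ} (hx : 0 < x) :
    0 < Ps (Dc a) x * Ps a x + x * (Ps (Dc (Dc a)) x * Ps a x - Ps (Dc a) x ^ 2) := by
  have hA := Ps_pos h h0 hx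
  have hB : 0 < Ps (Dc a) x := Ps_pos h.D (by simpa [Dc] using h1) hx
  have hC : HasSum (fun n : ℕ => (n : ℝ) * n * a n * x ^ n)
      (x * (x * Ps (Dc (Dc a)) x + Ps (Dc a) x)) := by
    rw [← hasSum_nat_add_iff' 1]
    have := ((h.D.hasSumD hx).add (h.D.hasSum hx)).mul_left x
    simp only [Finset.range_one, Finset.sum_singleton, Nat.cast_zero, zero_mul, sub_zero]
    refine hs_congr this fun n => ?_
    simp only [Dc]
    push_cast
    ring
  set A := Ps a x with hAd
  set B := Ps (Dc a) x
  set C := Ps (Dc (Dc a)) x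
  have hS := (hC.mul_left (A ^ 2)).add (((h.hasSumD hx).mul_left (-2 * A * (x * B))).add
    ((h.hasSum hx).mul_left ((x * B) ^ 2)))
  have hpos : 0 < ∑' n : ℕ, (A ^ 2 * ((n : ℝ) * n * a n * x ^ n) + (-2 * A * (x * B) * ((n : ℝ) * a n * x ^ n)
      + (x * B) ^ 2 * (a n * x ^ n))) := by
    refine hS.summable.tsum_pos (fun n => ?_) 0 ?_
    · have := h.1 n
      have : 0 ≤ (A * n - x * B) ^ 2 * (a n * x ^ n) := by positivity
      linarith
    · simp; positivity
  rw [hS.tsum_eq, ← hAd] at hpos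
  have : 0 < (A * x) * (B * A + x * (C * A - B ^ 2)) := by linarith
  exact (pos_iff_pos_of_mul_pos this).1 (by positivity)

lemma final_deriv {a : ℕ → ℝ} (h : Ent a) (h0 : 0 < a 0) {x y : ℝ} (hx : 0 < x) (hy : 0 < y) :
    HasFDerivAt (fun q : ℝ × ℝ => Ps (Dc a) (q.1 + q.2) / Ps a (q.1 + q.2))
      (((Ps (Dc (Dc a)) (x + y) * Ps a (x + y) - Ps (Dc a) (x + y) * Ps (Dc a) (x + y)) /
        Ps a (x + y) ^ 2) • (ContinuousLinearMap.fst ℝ ℝ ℝ + ContinuousLinearMap.snd ℝ ℝ ℝ)) (x, y) := by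
  have hxy : 0 < x + y := by positivity
  have h1 := (h.D.deriv hxy).div (h.deriv hxy) (Ps_pos h h0 hxy).ne'
  exact HasDerivAt.comp_hasFDerivAt (f := fun q : ℝ × ℝ => q.1 + q.2) (x, y) h1
    (hasFDerivAt_fst.add hasFDerivAt_snd)

/-- The colour densities `ρ^i(φ₁,φ₂) = E_{ν_{φ₁,φ₂}}[η_i]` are
differentiable on `(0,∞)²` with `∂ρ^i/∂φ_j = φ_j⁻¹ (E[η_i η_j] − ρ^i ρ^j)`, and the
determinant of the Jacobian `(∂ρ^i/∂φ_j)` is strictly positive on `(0,∞)²`. -/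
theorem stmt8 (c : ℕ → ℝ) (a₁ a₂ : ℝ) (k₀ : ℕ)
    (hc0 : c 0 = 0) (hcpos : ∀ k : ℕ, 1 ≤ k → 0 < c k)
    (hLG : ∀ k : ℕ, |c (k + 1) - c k| ≤ a₁)
    (hk₀ : 1 ≤ k₀) (ha₂ : 0 < a₂)
    (hM : ∀ k : ℕ, a₂ ≤ c (k + k₀) - c k) :
    ∀ φ₁ φ₂ : ℝ, 0 < φ₁ → 0 < φ₂ →
      ∃ d11 d12 d21 d22 : ℝ,
        d11 = φ₁⁻¹ * ((∑' p : ℕ × ℕ, (p.1 : ℝ) * (p.1 : ℝ) * nu2 c φ₁ φ₂ p) -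
          rho1 c φ₁ φ₂ * rho1 c φ₁ φ₂) ∧
        d12 = φ₂⁻¹ * ((∑' p : ℕ × ℕ, (p.1 : ℝ) * (p.2 : ℝ) * nu2 c φ₁ φ₂ p) -
          rho1 c φ₁ φ₂ * rho2 c φ₁ φ₂) ∧
        d21 = φ₁⁻¹ * ((∑' p : ℕ × ℕ, (p.2 : ℝ) * (p.1 : ℝ) * nu2 c φ₁ φ₂ p) -
          rho2 c φ₁ φ₂ * rho1 c φ₁ φ₂) ∧
        d22 = φ₂⁻¹ * ((∑' p : ℕ × ℕ, (p.2 : ℝ) * (p.2 : ℝ) * nu2 c φ₁ φ₂ p) -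
          rho2 c φ₁ φ₂ * rho2 c φ₁ φ₂) ∧
        HasFDerivAt (fun q : ℝ × ℝ => rho1 c q.1 q.2)
          (d11 • ContinuousLinearMap.fst ℝ ℝ ℝ + d12 • ContinuousLinearMap.snd ℝ ℝ ℝ)
          (φ₁, φ₂) ∧
        HasFDerivAt (fun q : ℝ × ℝ => rho2 c q.1 q.2)
          (d21 • ContinuousLinearMap.fst ℝ ℝ ℝ + d22 • ContinuousLinearMap.snd ℝ ℝ ℝ)
          (φ₁, φ₂) ∧
        0 < d11 * d22 - d12 * d21 := by
  intro φ₁ φ₂ h1 h2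
  set a : ℕ → ℝ := fun n => (cfact c n)⁻¹ with ha
  have hp := cfact_pos' c hcpos
  have hE : Ent a := ⟨fun n => (inv_pos.2 (hp n)).le,
    fun r hr => aux_summ c hcpos (aux_t c a₂ k₀ hcpos hc0 hk₀ ha₂ hM) r hr⟩
  have ha0 : 0 < a 0 := inv_pos.2 (hp 0)
  have ha1 : 0 < a 1 := inv_pos.2 (hp 1)
  have hZ : ∀ x, Zfun c x = Ps a x := by
    intro x
    refine tsum_congr fun n => ?_
    rw [ha]; ring
  have hnu : ∀ x y p, nu2 c x y p = Tm a x y p / Ps a (x + y) := by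
    intro x y p
    rw [nu2, hZ, Tm, ha]
    field_simp
  have hsum : ∀ (f : ℕ × ℕ → ℝ) (x y S : ℝ), HasSum (fun p => f p * Tm a x y p) S →
      ∑' p, f p * nu2 c x y p = S / Ps a (x + y) := by
    intro f x y S hS
    rw [← (hS.div_const _).tsum_eq]
    refine tsum_congr fun p => ?_
    rw [hnu]; ring
  have r1 : ∀ x y, 0 < x → 0 < y → rho1 c x y = x * (Ps (Dc a) (x + y) / Ps a (x + y)) := by
    intro x y hx hy
    rw [rho1, hsum (fun p => (p.1 : ℝ)) x y _ (hE.m1 hx hy)]; ring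
  have r2 : ∀ x y, 0 < x → 0 < y → rho2 c x y = y * (Ps (Dc a) (x + y) / Ps a (x + y)) := by
    intro x y hx hy
    rw [rho2, hsum (fun p => (p.2 : ℝ)) x y _ (hE.m2 hx hy)]; ring
  have e11 := hsum (fun p => (p.1 : ℝ) * p.1) φ₁ φ₂ _ (hE.m11 h1 h2)
  have e12 := hsum (fun p => (p.1 : ℝ) * p.2) φ₁ φ₂ _ (hE.m12 h1 h2)
  have e21 : ∑' p : ℕ × ℕ, (p.2 : ℝ) * (p.1 : ℝ) * nu2 c φ₁ φ₂ p = _ :=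
    (tsum_congr fun p => by rw [mul_comm (p.2 : ℝ)]).trans e12
  have e22 := hsum (fun p => (p.2 : ℝ) * p.2) φ₁ φ₂ _ (hE.m22 h1 h2)
  have hxy : 0 < φ₁ + φ₂ := by positivity
  have hA := Ps_pos hE ha0 hxy
  have hB : 0 < Ps (Dc a) (φ₁ + φ₂) := Ps_pos hE.D (by simpa [Dc] using ha1) hxy
  have hcs := strictCS hE ha0 ha1 hxy
  have hd := final_deriv hE ha0 h1 h2
  have hev : ∀ᶠ q : ℝ × ℝ in nhds (φ₁, φ₂), 0 < q.1 ∧ 0 < q.2 :=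
    (continuous_fst.continuousAt.eventually (lt_mem_nhds h1)).and
      (continuous_snd.continuousAt.eventually (lt_mem_nhds h2))
  refine ⟨_, _, _, _, rfl, rfl, rfl, rfl, ?_, ?_, ?_⟩
  · have := (hasFDerivAt_fst (𝕜 := ℝ) (p := (φ₁, φ₂))).mul hd
    refine (this.congr_of_eventuallyEq (hev.mono fun q hq => r1 _ _ hq.1 hq.2)).congr_fderiv ?_
    rw [e11, e12, r1 _ _ h1 h2, r2 _ _ h1 h2]
    ext <;> simp <;> field_simp <;> ring
  · have := (hasFDerivAt_snd (𝕜 := ℝ) (p := (φ₁, φ₂))).mul hd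
    refine (this.congr_of_eventuallyEq (hev.mono fun q hq => r2 _ _ hq.1 hq.2)).congr_fderiv ?_
    rw [e21, e22, r1 _ _ h1 h2, r2 _ _ h1 h2]
    ext <;> simp <;> field_simp <;> ring
  · rw [e11, e12, e21, e22, r1 _ _ h1 h2, r2 _ _ h1 h2]
    generalize Ps (Dc (Dc a)) (φ₁ + φ₂) = C at *
    generalize Ps (Dc a) (φ₁ + φ₂) = B at *
    generalize Ps a (φ₁ + φ₂) = A at *
    have : 0 < B * (B * A + (φ₁ + φ₂) * (C * A - B ^ 2)) / A ^ 3 := by positivity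
    convert this using 1
    field_simp
    ring
end
end

section
/- Garcia–Rodemich–Rumsey inequality (special case): let T > 0, let g : [0,T] → ℝ be continuous, and let ψ : [0,∞) → [0,∞) be continuous and strictly increasing with ψ(0) = 0 and ψ(u) → ∞ as u → ∞. Set B := ∫₀^T ∫₀^T ψ( |g(t) − g(s)| / √|t − s| ) ds dt and assume B < ∞. Then for all 0 ≤ s ≤ t ≤ T, |g(t) − g(s)| ≤ 8 ∫₀^{t−s} ψ^{−1}(4B/u²) · u^{−1/2} du. -/
open MeasureTheory

lemma grr_markov {J : Set ℝ} {d A : ℝ} (hd : 0 < d) (hA : 0 ≤ A) (f : ℝ → ENNReal)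
    (hf : Measurable f) (h : ∫⁻ y in J, f y ≤ ENNReal.ofReal A) :
    volume.restrict J {y | ENNReal.ofReal (3 * A / d) < f y} ≤ ENNReal.ofReal (d / 3) := by
  rcases hA.eq_or_lt with h0 | h0
  · subst h0
    have h1 : ∫⁻ y in J, f y = 0 := by simpa using h
    rw [lintegral_eq_zero_iff hf] at h1
    have : volume.restrict J {y | ENNReal.ofReal (3 * 0 / d) < f y} = 0 := by
      rw [Filter.EventuallyEq, ae_iff] at h1
      refine measure_mono_null ?_ h1
      intro y hy
      simp only [Set.mem_ofPred_eq, Pi.zero_apply] at hy ⊢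
      exact (lt_of_le_of_lt bot_le hy).ne'
    rw [this]; exact bot_le
  · have h1 := mul_meas_ge_le_lintegral (μ := volume.restrict J) hf (ENNReal.ofReal (3 * A / d))
    have h2 := h1.trans h
    have hp : 0 < 3 * A / d := by positivity
    have h3 : volume.restrict J {y | ENNReal.ofReal (3 * A / d) ≤ f y} ≤ ENNReal.ofReal (d / 3) := by
      have e : ENNReal.ofReal A = ENNReal.ofReal (3 * A / d) * ENNReal.ofReal (d / 3) := by
        rw [← ENNReal.ofReal_mul hp.le]; congr 1; field_simp
      rw [e] at h2
      exact (ENNReal.mul_le_mul_iff_right (by simpa using hp) ENNReal.ofReal_ne_top).1 h2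
    refine (measure_mono ?_).trans h3
    intro y hy
    simp only [Set.mem_ofPred_eq] at hy ⊢
    exact hy.le

lemma grr_pick {J : Set ℝ} {d A₁ A₂ : ℝ} (hJ : MeasurableSet J) (hd : 0 < d)
    (hv : volume J = ENNReal.ofReal d) (hA₁ : 0 ≤ A₁) (hA₂ : 0 ≤ A₂) (f₁ f₂ : ℝ → ENNReal)
    (hf₁ : Measurable f₁) (hf₂ : Measurable f₂)
    (h₁ : ∫⁻ y in J, f₁ y ≤ ENNReal.ofReal A₁) (h₂ : ∫⁻ y in J, f₂ y ≤ ENNReal.ofReal A₂) :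
    ∃ y ∈ J, f₁ y ≤ ENNReal.ofReal (3 * A₁ / d) ∧ f₂ y ≤ ENNReal.ofReal (3 * A₂ / d) := by
  by_contra! hc
  have m1 := grr_markov hd hA₁ f₁ hf₁ h₁
  have m2 := grr_markov hd hA₂ f₂ hf₂ h₂
  have hsub : J ⊆ {y | ENNReal.ofReal (3 * A₁ / d) < f₁ y} ∪
      {y | ENNReal.ofReal (3 * A₂ / d) < f₂ y} := by
    intro y hy
    by_cases h : f₁ y ≤ ENNReal.ofReal (3 * A₁ / d)
    · exact Or.inr (hc y hy h)
    · exact Or.inl (not_le.1 h)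
  have e : volume.restrict J J = ENNReal.ofReal d := by
    rw [Measure.restrict_apply hJ, Set.inter_self, hv]
  have : ENNReal.ofReal d ≤ ENNReal.ofReal (d / 3) + ENNReal.ofReal (d / 3) := by
    rw [← e]
    exact (measure_mono hsub).trans ((measure_union_le _ _).trans (add_le_add m1 m2))
  rw [← ENNReal.ofReal_add (by positivity) (by positivity),
    ENNReal.ofReal_le_ofReal_iff (by positivity)] at this
  linarith

lemma grr_side {s t c B : ℝ} (hB : 0 ≤ B) (g W : ℝ → ℝ) (F : ℝ → ℝ → ENNReal)
    (hgc : ContinuousAt g c)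
    (hF : Measurable (Function.uncurry F))
    (hW0 : ∀ v, 0 ≤ v → 0 ≤ W v) (hWm : ∀ v w, 0 ≤ v → v ≤ w → W v ≤ W w)
    (hFB : ∫⁻ x in Set.Icc s t, ∫⁻ y in Set.Icc s t, F x y ≤ ENNReal.ofReal B)
    (hFW : ∀ x y v, x ∈ Set.Icc s t → y ∈ Set.Icc s t → 0 ≤ v → F x y ≤ ENNReal.ofReal v →
      |g x - g y| ≤ W v * Real.sqrt |x - y|)
    (hJ : ∀ d, 0 < d → d ≤ t - s → ∃ J : Set ℝ, MeasurableSet J ∧ J ⊆ Set.Icc s t ∧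
      volume J = ENNReal.ofReal d ∧ ∀ y ∈ J, 0 < |y - c| ∧ |y - c| ≤ d)
    (hcL : ∀ y ∈ Set.Icc s t, |y - c| ≤ t - s)
    (x₀ : ℝ) (hx₀ : x₀ ∈ Set.Icc s t) (hx₀c : 0 < |x₀ - c|)
    (hI₀ : ∫⁻ y in Set.Icc s t, F x₀ y ≤ ENNReal.ofReal (3 * B / |x₀ - c|)) :
    ENNReal.ofReal |g x₀ - g c| ≤
      4 * ∫⁻ u in Set.Ioc (0 : ℝ) (t - s), ENNReal.ofReal (W (4 * B / u ^ 2) / Real.sqrt u) := by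
  set φ : ℝ → ENNReal := fun u => ENNReal.ofReal (W (4 * B / u ^ 2) / Real.sqrt u) with hφ
  have hI : Measurable (fun x => ∫⁻ y in Set.Icc s t, F x y) := hF.lintegral_prod_right'
  have step : ∀ x, x ∈ Set.Icc s t → 0 < |x - c| →
      (∫⁻ y in Set.Icc s t, F x y ≤ ENNReal.ofReal (3 * B / |x - c|)) →
      ∃ y, y ∈ Set.Icc s t ∧ 0 < |y - c| ∧
        (∫⁻ z in Set.Icc s t, F y z ≤ ENNReal.ofReal (3 * B / |y - c|)) ∧
        |y - c| ≤ |x - c| / 4 ∧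
        ENNReal.ofReal |g x - g y| ≤ 4 * ∫⁻ u in Set.Ioc (|y - c| / 4) (|x - c| / 4), φ u := by
    intro x hx hxc hIx
    set d := |x - c| / 4 with hd
    have hd0 : 0 < d := by positivity
    have hxd : |x - c| = 4 * d := by rw [hd]; ring
    obtain ⟨J, hJm, hJs, hJv, hJc⟩ := hJ d hd0 (by have := hcL x hx; linarith)
    obtain ⟨y, hyJ, hy1, hy2⟩ := grr_pick hJm hd0 hJv hB (A₂ := 3 * B / |x - c|) (by positivity)
      (fun x => ∫⁻ y in Set.Icc s t, F x y) (fun y => F x y) hI (hF.of_uncurry_left)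
      ((lintegral_mono_set hJs).trans hFB) ((lintegral_mono_set hJs).trans hIx)
    obtain ⟨hy0, hyd⟩ := hJc y hyJ
    refine ⟨y, hJs hyJ, hy0, hy1.trans (ENNReal.ofReal_le_ofReal ?_), hyd, ?_⟩
    · exact div_le_div_of_nonneg_left (by positivity) hy0 hyd
    have hv : F x y ≤ ENNReal.ofReal (4 * B / d ^ 2) := by
      refine hy2.trans (ENNReal.ofReal_le_ofReal ?_)
      rw [hxd]
      have : 3 * (3 * B / (4 * d)) / d = (9 / 4) * (B / d ^ 2) := by field_simp; ring
      rw [this]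
      have h2 : 4 * B / d ^ 2 = 4 * (B / d ^ 2) := by ring
      have : 0 ≤ B / d ^ 2 := by positivity
      linarith
    have hv0 : 0 ≤ 4 * B / d ^ 2 := by positivity
    have hg1 := hFW x y _ hx (hJs hyJ) hv0 hv
    have hw := hW0 _ hv0
    set w := W (4 * B / d ^ 2)
    have hsq : Real.sqrt |x - y| ≤ 3 * Real.sqrt d := by
      have : |x - y| ≤ 9 * d := by
        have h1 : |x - y| ≤ |x - c| + |y - c| := by
          have := abs_sub (x - c) (y - c); simpa using this
        linarith
      calc Real.sqrt |x - y| ≤ Real.sqrt (9 * d) := Real.sqrt_le_sqrt this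
        _ = 3 * Real.sqrt d := by
          rw [Real.sqrt_mul (by norm_num), show (9 : ℝ) = 3 ^ 2 by norm_num,
            Real.sqrt_sq (by norm_num)]
    have hg2 : |g x - g y| ≤ 4 * ((w / Real.sqrt d) * (3 * d / 4)) := by
      have hsd : 0 < Real.sqrt d := Real.sqrt_pos.2 hd0
      have : 4 * ((w / Real.sqrt d) * (3 * d / 4)) = w * (3 * Real.sqrt d) := by
        have h := Real.mul_self_sqrt hd0.le
        field_simp
        nlinarith
      rw [this]
      exact hg1.trans (mul_le_mul_of_nonneg_left hsq hw)
    calc ENNReal.ofReal |g x - g y|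
        ≤ ENNReal.ofReal (4 * ((w / Real.sqrt d) * (3 * d / 4))) := ENNReal.ofReal_le_ofReal hg2
      _ = 4 * (ENNReal.ofReal (w / Real.sqrt d) * ENNReal.ofReal (3 * d / 4)) := by
          rw [ENNReal.ofReal_mul (by norm_num), ENNReal.ofReal_mul (by positivity)]
          norm_num
      _ = 4 * ∫⁻ u in Set.Ioc (d / 4) d, ENNReal.ofReal (w / Real.sqrt d) := by
          rw [setLIntegral_const, Real.volume_Ioc]
          congr 3; ring
      _ ≤ 4 * ∫⁻ u in Set.Ioc (d / 4) d, φ u := by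
          refine mul_le_mul_right (setLIntegral_mono' measurableSet_Ioc ?_) _
          intro u hu
          have hu0 : 0 < u := lt_trans (by positivity) hu.1
          refine ENNReal.ofReal_le_ofReal ?_
          have hm : w ≤ W (4 * B / u ^ 2) := by
            refine hWm _ _ hv0 ?_
            have : u ^ 2 ≤ d ^ 2 := pow_le_pow_left₀ hu0.le hu.2 2
            exact div_le_div_of_nonneg_left (by positivity) (by positivity) this
          exact div_le_div₀ (hw.trans hm) hm (Real.sqrt_pos.2 hu0) (Real.sqrt_le_sqrt hu.2)
      _ ≤ 4 * ∫⁻ u in Set.Ioc (|y - c| / 4) d, φ u := by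
          refine mul_le_mul_right (lintegral_mono_set (Set.Ioc_subset_Ioc_left ?_)) _
          linarith
  have iter : ∀ n : ℕ, ∃ y, y ∈ Set.Icc s t ∧ 0 < |y - c| ∧
        (∫⁻ z in Set.Icc s t, F y z ≤ ENNReal.ofReal (3 * B / |y - c|)) ∧
        |y - c| ≤ |x₀ - c| * (1 / 4) ^ n ∧
        ENNReal.ofReal |g x₀ - g y| ≤
          4 * ∫⁻ u in Set.Ioc (|y - c| / 4) (|x₀ - c| / 4), φ u := by
    intro n
    induction n with
    | zero => exact ⟨x₀, hx₀, hx₀c, hI₀, by simp, by simp⟩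
    | succ n ih =>
      obtain ⟨y, hy, hyc, hyI, hyn, hyg⟩ := ih
      obtain ⟨z, hz, hzc, hzI, hzn, hzg⟩ := step y hy hyc hyI
      refine ⟨z, hz, hzc, hzI, ?_, ?_⟩
      · rw [pow_succ]; linarith
      have hle : |y - c| ≤ |x₀ - c| := hyn.trans
        (mul_le_of_le_one_right hx₀c.le (pow_le_one₀ (by norm_num) (by norm_num)))
      rw [← Set.Ioc_union_Ioc_eq_Ioc (b := |y - c| / 4) (by linarith) (by linarith),
        lintegral_union measurableSet_Ioc (Set.Ioc_disjoint_Ioc_of_le le_rfl), mul_add]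
      calc ENNReal.ofReal |g x₀ - g z|
          ≤ ENNReal.ofReal (|g y - g z| + |g x₀ - g y|) := by
            refine ENNReal.ofReal_le_ofReal ?_
            have := abs_sub_le (g x₀) (g y) (g z); linarith
        _ = ENNReal.ofReal |g y - g z| + ENNReal.ofReal |g x₀ - g y| :=
            ENNReal.ofReal_add (abs_nonneg _) (abs_nonneg _)
        _ ≤ _ := add_le_add hzg hyg
  choose y hy hyc hyI hyn hyg using iter
  have hlim : Filter.Tendsto y Filter.atTop (nhds c) := by
    rw [tendsto_iff_dist_tendsto_zero]
    have h0 : Filter.Tendsto (fun n : ℕ => |x₀ - c| * (1 / 4 : ℝ) ^ n) Filter.atTop (nhds 0) := by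
      have := (tendsto_pow_atTop_nhds_zero_of_lt_one (r := (1 / 4 : ℝ)) (by norm_num)
        (by norm_num)).const_mul |x₀ - c|
      simpa using this
    exact squeeze_zero (fun _ => dist_nonneg) (fun n => by rw [Real.dist_eq]; exact hyn n) h0
  have hlim2 : Filter.Tendsto (fun n => ENNReal.ofReal |g x₀ - g (y n)|) Filter.atTop
      (nhds (ENNReal.ofReal |g x₀ - g c|)) :=
    ENNReal.tendsto_ofReal ((tendsto_const_nhds.sub (hgc.tendsto.comp hlim)).abs)
  refine le_of_tendsto' hlim2 fun n => (hyg n).trans ?_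
  refine mul_le_mul_right (lintegral_mono_set (Set.Ioc_subset_Ioc ?_ ?_)) _
  · positivity
  · have := hcL x₀ hx₀; linarith

/-- Garcia–Rodemich–Rumsey inequality (special case): let `T > 0`,
`g : [0,T] → ℝ` continuous, and `ψ : [0,∞) → [0,∞)` continuous, strictly increasing,
with `ψ(0) = 0` and `ψ(u) → ∞`, with inverse `ψ⁻¹`.  Set
`B = ∫₀^T ∫₀^T ψ(|g(t) − g(s)|/√|t−s|) ds dt` and assume `B < ∞` (integrability).
Then for all `0 ≤ s ≤ t ≤ T`, `|g(t) − g(s)| ≤ 8 ∫₀^{t−s} ψ⁻¹(4B/u²) u^{−1/2} du`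
(the right-hand side, a Lebesgue integral of a nonnegative function, may be infinite). -/
theorem stmt16 (T : ℝ) (hT : 0 < T) (g ψ ψinv : ℝ → ℝ)
    (hg : ContinuousOn g (Set.Icc 0 T))
    (hψ0 : ψ 0 = 0)
    (hψmono : StrictMonoOn ψ (Set.Ici 0))
    (hψcont : ContinuousOn ψ (Set.Ici 0))
    (hψnonneg : ∀ u : ℝ, 0 ≤ u → 0 ≤ ψ u)
    (hψtop : Filter.Tendsto ψ Filter.atTop Filter.atTop)
    (hinv1 : ∀ u : ℝ, 0 ≤ u → ψinv (ψ u) = u)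
    (hinv2 : ∀ v : ℝ, 0 ≤ v → 0 ≤ ψinv v ∧ ψ (ψinv v) = v)
    (hBint : IntegrableOn
      (fun p : ℝ × ℝ => ψ (|g p.1 - g p.2| / Real.sqrt |p.1 - p.2|))
      (Set.Icc 0 T ×ˢ Set.Icc 0 T))
    (B : ℝ)
    (hB : B = ∫ p in Set.Icc (0 : ℝ) T ×ˢ Set.Icc (0 : ℝ) T,
      ψ (|g p.1 - g p.2| / Real.sqrt |p.1 - p.2|)) :
    ∀ s t : ℝ, 0 ≤ s → s ≤ t → t ≤ T →
      ENNReal.ofReal |g t - g s| ≤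
        8 * ∫⁻ u in Set.Ioc (0 : ℝ) (t - s),
          ENNReal.ofReal (ψinv (4 * B / u ^ 2) / Real.sqrt u) := by
  intro s t hs hst htT
  rcases hst.eq_or_lt with h | hlt
  · subst h; simp
  have hWm : ∀ v w, 0 ≤ v → v ≤ w → ψinv v ≤ ψinv w := by
    intro v w hv hvw
    obtain ⟨a, b⟩ := hinv2 v hv
    obtain ⟨a', b'⟩ := hinv2 w (hv.trans hvw)
    rw [← hψmono.le_iff_le (show ψinv v ∈ Set.Ici 0 from a) (show ψinv w ∈ Set.Ici 0 from a'), b, b']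
    exact hvw
  set G : ℝ → ℝ := Set.IccExtend hT.le ((Set.Icc 0 T).restrict g) with hG
  have hGc : Continuous G := (continuousOn_iff_continuous_restrict.1 hg).Icc_extend'
  have hGg : ∀ x ∈ Set.Icc 0 T, G x = g x := fun x hx => by
    rw [hG, Set.IccExtend_of_mem _ _ hx]; rfl
  set P : ℝ → ℝ := fun u => ψ (max u 0) with hP
  have hPc : Continuous P := hψcont.comp_continuous (by fun_prop) (fun u => le_max_right u 0)
  have hPψ : ∀ u, 0 ≤ u → P u = ψ u := fun u hu => by simp [hP, max_eq_left hu]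
  set F : ℝ → ℝ → ENNReal := fun x y => ENNReal.ofReal (P (|G x - G y| / Real.sqrt |x - y|)) with hFdef
  have hF : Measurable (Function.uncurry F) := by
    have hGm := hGc.measurable
    have hPm := hPc.measurable
    have : Measurable (fun p : ℝ × ℝ =>
        ENNReal.ofReal (P (|G p.1 - G p.2| / Real.sqrt |p.1 - p.2|))) := by
      refine ENNReal.measurable_ofReal.comp (hPm.comp (Measurable.div ?_ ?_))
      · exact (continuous_abs.comp (by fun_prop :
          Continuous (fun p : ℝ × ℝ => G p.1 - G p.2))).measurable
      · exact (by fun_prop : Continuous (fun p : ℝ × ℝ => Real.sqrt |p.1 - p.2|)).measurable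
    exact this
  have hms : MeasurableSet (Set.Icc (0 : ℝ) T ×ˢ Set.Icc (0 : ℝ) T) :=
    measurableSet_Icc.prod measurableSet_Icc
  have hnn : ∀ p : ℝ × ℝ, 0 ≤ ψ (|g p.1 - g p.2| / Real.sqrt |p.1 - p.2|) :=
    fun p => hψnonneg _ (by positivity)
  have hB0 : 0 ≤ B := by rw [hB]; exact integral_nonneg hnn
  have hsub : Set.Icc s t ⊆ Set.Icc 0 T := Set.Icc_subset_Icc hs htT
  have hFB : ∫⁻ x in Set.Icc s t, ∫⁻ y in Set.Icc s t, F x y ≤ ENNReal.ofReal B := by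
    calc ∫⁻ x in Set.Icc s t, ∫⁻ y in Set.Icc s t, F x y
        ≤ ∫⁻ x in Set.Icc 0 T, ∫⁻ y in Set.Icc 0 T, F x y :=
          (lintegral_mono fun x => lintegral_mono_set hsub).trans (lintegral_mono_set hsub)
      _ = ∫⁻ p in Set.Icc 0 T ×ˢ Set.Icc 0 T, Function.uncurry F p := by
          rw [Measure.volume_eq_prod, ← Measure.prod_restrict, lintegral_prod _ hF.aemeasurable]
          rfl
      _ = ∫⁻ p in Set.Icc 0 T ×ˢ Set.Icc 0 T,
            ENNReal.ofReal (ψ (|g p.1 - g p.2| / Real.sqrt |p.1 - p.2|)) := by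
          refine setLIntegral_congr_fun hms ?_
          rintro ⟨x, y⟩ ⟨hx, hy⟩
          simp only [Function.uncurry, hFdef]
          rw [hPψ _ (by positivity), hGg x hx, hGg y hy]
      _ = ENNReal.ofReal B := by
          rw [hB, ofReal_integral_eq_lintegral_ofReal hBint (Filter.Eventually.of_forall hnn)]
      _ ≤ _ := le_rfl
  have hFW : ∀ x y v, x ∈ Set.Icc s t → y ∈ Set.Icc s t → 0 ≤ v → F x y ≤ ENNReal.ofReal v →
      |G x - G y| ≤ ψinv v * Real.sqrt |x - y| := by
    intro x y v hx hy hv h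
    rcases eq_or_ne x y with rfl | hne
    · simp
    have hpos : 0 < Real.sqrt |x - y| := Real.sqrt_pos.2 (abs_pos.2 (sub_ne_zero.2 hne))
    have hr : 0 ≤ |G x - G y| / Real.sqrt |x - y| := by positivity
    rw [hFdef] at h
    simp only at h
    rw [hPψ _ hr, ENNReal.ofReal_le_ofReal_iff hv] at h
    have := hWm _ _ (hψnonneg _ hr) h
    rw [hinv1 _ hr, div_le_iff₀ hpos] at this
    exact this
  have hL : 0 < t - s := sub_pos.2 hlt
  have hI : Measurable (fun x => ∫⁻ y in Set.Icc s t, F x y) := hF.lintegral_prod_right'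
  obtain ⟨x₀, hx₀, hI₀, -⟩ := grr_pick (J := Set.Ioo s t) measurableSet_Ioo hL
    Real.volume_Ioo hB0 hB0 (fun x => ∫⁻ y in Set.Icc s t, F x y)
    (fun x => ∫⁻ y in Set.Icc s t, F x y) hI hI
    ((lintegral_mono_set Set.Ioo_subset_Icc_self).trans hFB)
    ((lintegral_mono_set Set.Ioo_subset_Icc_self).trans hFB)
  have hx₀' := Set.Ioo_subset_Icc_self hx₀
  have hcs : ∀ y ∈ Set.Icc s t, |y - s| ≤ t - s := fun y hy => by
    rw [abs_le]; constructor <;> linarith [hy.1, hy.2]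
  have hct : ∀ y ∈ Set.Icc s t, |y - t| ≤ t - s := fun y hy => by
    rw [abs_le]; constructor <;> linarith [hy.1, hy.2]
  have hps : 0 < |x₀ - s| := abs_pos.2 (sub_ne_zero.2 hx₀.1.ne')
  have hpt : 0 < |x₀ - t| := abs_pos.2 (sub_ne_zero.2 hx₀.2.ne)
  have A := grr_side (c := s) hB0 G ψinv F hGc.continuousAt hF (fun v hv => (hinv2 v hv).1) hWm hFB hFW
    (fun d hd hdL => ⟨Set.Ioc s (s + d), measurableSet_Ioc,
      fun y hy => ⟨hy.1.le, by linarith [hy.2]⟩, by rw [Real.volume_Ioc]; congr 1; ring,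
      fun y hy => ⟨abs_pos.2 (sub_ne_zero.2 hy.1.ne'), by
        rw [abs_le]; constructor <;> linarith [hy.1, hy.2]⟩⟩) hcs x₀ hx₀' hps
    (hI₀.trans (ENNReal.ofReal_le_ofReal
      (div_le_div_of_nonneg_left (by positivity) hps (hcs x₀ hx₀'))))
  have A' := grr_side (c := t) hB0 G ψinv F hGc.continuousAt hF (fun v hv => (hinv2 v hv).1) hWm hFB hFW
    (fun d hd hdL => ⟨Set.Ico (t - d) t, measurableSet_Ico,
      fun y hy => ⟨by linarith [hy.1], hy.2.le⟩, by rw [Real.volume_Ico]; congr 1; ring,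
      fun y hy => ⟨abs_pos.2 (sub_ne_zero.2 hy.2.ne), by
        rw [abs_le]; constructor <;> linarith [hy.1, hy.2]⟩⟩) hct x₀ hx₀' hpt
    (hI₀.trans (ENNReal.ofReal_le_ofReal
      (div_le_div_of_nonneg_left (by positivity) hpt (hct x₀ hx₀'))))
  rw [← hGg t ⟨hs.trans hst, htT⟩, ← hGg s ⟨hs, hst.trans htT⟩]
  calc ENNReal.ofReal |G t - G s|
      ≤ ENNReal.ofReal (|G x₀ - G s| + |G x₀ - G t|) := by
        refine ENNReal.ofReal_le_ofReal ?_
        have := abs_sub_le (G t) (G x₀) (G s)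
        rw [abs_sub_comm (G t) (G x₀)] at this
        linarith
    _ = ENNReal.ofReal |G x₀ - G s| + ENNReal.ofReal |G x₀ - G t| :=
        ENNReal.ofReal_add (abs_nonneg _) (abs_nonneg _)
    _ ≤ _ := add_le_add A A'
    _ = _ := by rw [← add_mul]; norm_num
end
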